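/- Let P be a finite set of n ≥ 2 point sites in the Euclidean plane, let p ∈ P, let d be a nonzero vector, and suppose there exists t₀ > 0 with p + t₀·d in the farthest-site Voronoi cell F(p). Define T = {t > 0 : there exists q ∈ P \ {p} with dist(p + t·d, q) = dist(p + t·d, p)}. Then T is nonempty and bounded above, its supremum t* satisfies t* ∈ T and t* ≤ t₀, the point p + t*·d lies on the topological frontier of F(p), and p + t·d ∈ F(p) for every t > t*. -/

import Mathlib

noncomputable section

abbrev Plane := EuclideanSpace ℝ (Fin 2)

/-- The farthest-site Voronoi cell of `p` with respect to the site set `P`. -/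
def farCell (P : Finset Plane) (p : Plane) : Set Plane :=
  {x | ∀ q ∈ P, q ≠ p → dist x q < dist x p}

/-- The set of positive parameters `t` at which the point `p + t • d` is
equidistant from `p` and some other site of `P`. -/
def crossTimes (P : Finset Plane) (p d : Plane) : Set ℝ :=
  {t | 0 < t ∧ ∃ q ∈ P, q ≠ p ∧ dist (p + t • d) q = dist (p + t • d) p}

open scoped RealInnerProductSpace

section Bisector

variable {E : Type*} [NormedAddCommGroup E] [InnerProductSpace ℝ E]

/-- The parameter at which the ray from `p` in direction `d` crosses the bisector of `p` and `q`. -/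
def bisectorTime (p d q : E) : ℝ := ‖q - p‖ ^ 2 / (2 * ⟪d, q - p⟫)

theorem dist_add_smul_sq_sub (p d q : E) (t : ℝ) :
    dist (p + t • d) q ^ 2 - dist (p + t • d) p ^ 2 = ‖q - p‖ ^ 2 - t * (2 * ⟪d, q - p⟫) := by
  have h : p + t • d - q = t • d - (q - p) := by abel
  rw [dist_eq_norm, dist_eq_norm, h, add_sub_cancel_left, norm_sub_sq_real, real_inner_smul_left]
  ring

theorem dist_add_smul_lt_iff (p d q : E) (t : ℝ) :
    dist (p + t • d) q < dist (p + t • d) p ↔ ‖q - p‖ ^ 2 < t * (2 * ⟪d, q - p⟫) := by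
  rw [← sq_lt_sq₀ dist_nonneg dist_nonneg, ← sub_neg, dist_add_smul_sq_sub, sub_neg]

theorem dist_add_smul_eq_iff (p d q : E) (t : ℝ) :
    dist (p + t • d) q = dist (p + t • d) p ↔ ‖q - p‖ ^ 2 = t * (2 * ⟪d, q - p⟫) := by
  rw [← sq_eq_sq₀ dist_nonneg dist_nonneg, ← sub_eq_zero, dist_add_smul_sq_sub, sub_eq_zero]

theorem inner_pos_of_dist_add_smul_lt {p d q : E} {t : ℝ} (ht : 0 < t)
    (h : dist (p + t • d) q < dist (p + t • d) p) : 0 < ⟪d, q - p⟫ := by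
  rw [dist_add_smul_lt_iff] at h
  have := pos_of_mul_pos_right ((sq_nonneg _).trans_lt h) ht.le
  linarith

theorem dist_add_smul_lt_iff_bisectorTime_lt {p d q : E} (h : 0 < ⟪d, q - p⟫) (t : ℝ) :
    dist (p + t • d) q < dist (p + t • d) p ↔ bisectorTime p d q < t := by
  rw [dist_add_smul_lt_iff, bisectorTime, div_lt_iff₀ (by positivity)]

theorem dist_add_smul_eq_iff_bisectorTime_eq {p d q : E} (h : 0 < ⟪d, q - p⟫) (t : ℝ) :
    dist (p + t • d) q = dist (p + t • d) p ↔ bisectorTime p d q = t := by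
  rw [dist_add_smul_eq_iff, bisectorTime, div_eq_iff (by positivity)]

theorem bisectorTime_pos {p d q : E} (h : 0 < ⟪d, q - p⟫) : 0 < bisectorTime p d q := by
  have hq : q - p ≠ 0 := by
    rintro hq
    simp [hq] at h
  exact div_pos (pow_pos (norm_pos_iff.mpr hq) 2) (by positivity)

end Bisector

theorem ray_in_farCell_beyond_last_bisector
    (P : Finset Plane) (hn : 2 ≤ P.card) (p : Plane) (hp : p ∈ P)
    (d : Plane) (hd : d ≠ 0)
    (t₀ : ℝ) (ht₀ : 0 < t₀) (h₀ : p + t₀ • d ∈ farCell P p) :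
    (crossTimes P p d).Nonempty ∧
    BddAbove (crossTimes P p d) ∧
    sSup (crossTimes P p d) ∈ crossTimes P p d ∧
    sSup (crossTimes P p d) ≤ t₀ ∧
    p + sSup (crossTimes P p d) • d ∈ frontier (farCell P p) ∧
    (∀ t : ℝ, sSup (crossTimes P p d) < t → p + t • d ∈ farCell P p) := by
  have hpos : ∀ q ∈ P, q ≠ p → 0 < ⟪d, q - p⟫ := fun q hq hqp =>
    inner_pos_of_dist_add_smul_lt ht₀ (h₀ q hq hqp)
  have hne : (P.erase p).Nonempty := by
    rw [← Finset.card_pos, Finset.card_erase_of_mem hp]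
    omega
  obtain ⟨r, hr, hmax⟩ := Finset.exists_max_image (P.erase p) (bisectorTime p d) hne
  obtain ⟨hrp, hrP⟩ := Finset.mem_erase.mp hr
  have hrpos := hpos r hrP hrp
  have htie := (dist_add_smul_eq_iff_bisectorTime_eq hrpos _).mpr rfl
  have hgreatest : IsGreatest (crossTimes P p d) (bisectorTime p d r) := by
    refine ⟨⟨bisectorTime_pos hrpos, r, hrP, hrp, htie⟩, ?_⟩
    rintro t ⟨-, q, hq, hqp, ht⟩
    rw [← (dist_add_smul_eq_iff_bisectorTime_eq (hpos q hq hqp) t).mp ht]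
    exact hmax q (Finset.mem_erase.mpr ⟨hqp, hq⟩)
  have hcell : ∀ t, bisectorTime p d r < t → p + t • d ∈ farCell P p := fun t ht q hq hqp =>
    (dist_add_smul_lt_iff_bisectorTime_lt (hpos q hq hqp) t).mpr
      ((hmax q (Finset.mem_erase.mpr ⟨hqp, hq⟩)).trans_lt ht)
  rw [hgreatest.isLUB.csSup_eq hgreatest.nonempty]
  refine ⟨hgreatest.nonempty, hgreatest.bddAbove, hgreatest.1, ?_, ⟨?_, ?_⟩, hcell⟩
  · exact ((dist_add_smul_lt_iff_bisectorTime_lt hrpos t₀).mp (h₀ r hrP hrp)).le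
  · have hcont : Continuous fun t : ℝ => p + t • d := by fun_prop
    refine map_mem_closure (s := Set.Ioi (bisectorTime p d r)) hcont ?_ hcell
    rw [closure_Ioi]
    exact Set.self_mem_Ici
  · exact fun hint => (interior_subset hint r hrP hrp).ne htie
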